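/- Let a > 0 be a real number, let k* = (ln 2)/a, and define F : (0, ∞) → ℝ by F(k) = (1 - e^{-ak})^k. Then F is strictly decreasing on (0, k*] and strictly increasing on [k*, ∞). That is, as the number of hash functions k increases with m and n fixed, the approximate Bloom filter false positive rate first decreases, reaches a minimum at k = (m ln 2)/n, and then increases. -/

import Mathlib

open Real in
theorem strictMonoOn_log_mul_log_one_sub :
    StrictMonoOn (fun p : ℝ => log p * log (1 - p)) (Set.Ioc 0 (1 / 2)) := by
  refine strictMonoOn_of_deriv_pos (convex_Ioc _ _) ?_ ?_
  · intro p hp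
    have h0 : p ≠ 0 := hp.1.ne'
    have h1 : 1 - p ≠ 0 := by linarith [hp.2]
    exact ((continuousAt_log h0).mul
      ((continuousAt_const.sub continuousAt_id).log h1)).continuousWithinAt
  · intro p hp
    rw [interior_Ioc] at hp
    obtain ⟨hp0, hp2⟩ := hp
    have h1 : 0 < 1 - p := by linarith
    have hd : HasDerivAt (fun p : ℝ => log p * log (1 - p))
        (p⁻¹ * log (1 - p) + log p * (-1 / (1 - p))) p :=
      (hasDerivAt_log hp0.ne').mul (((hasDerivAt_id p).const_sub 1).log h1.ne')
    rw [hd.deriv]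
    have hs := strictConcaveOn_log_Ioi.secant_strict_mono (a := 1) (x := p) (y := 1 - p)
      (Set.mem_Ioi.2 one_pos) (Set.mem_Ioi.2 hp0) (Set.mem_Ioi.2 h1)
      (by linarith) (by linarith) (by linarith)
    have e1 : (log (1 - p) - log 1) / (1 - p - 1) = -(p⁻¹ * log (1 - p)) := by
      rw [log_one, sub_zero, show 1 - p - 1 = -p by ring, div_neg, div_eq_inv_mul]
    have e2 : (log p - log 1) / (p - 1) = log p * (-1 / (1 - p)) := by
      rw [log_one, sub_zero, ← neg_sub 1 p, div_neg, mul_div_assoc', mul_neg_one, neg_div]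
    rw [e1, e2] at hs
    linarith

open Real in
theorem one_sub_exp_rpow_eq {a k : ℝ} (ha : 0 < a) (hk : 0 < k) :
    (1 - exp (-a * k)) ^ k =
      exp (-(log (exp (-a * k)) * log (1 - exp (-a * k))) / a) := by
  have hp : exp (-a * k) < 1 := exp_lt_one_iff.2 (by nlinarith)
  rw [rpow_def_of_pos (by linarith), log_exp]
  congr 1
  field_simp


/-- Let `a > 0`, `k* = (ln 2)/a`, and `F k = (1 - e^(-a k))^k` (real exponent).  Then
`F` is strictly decreasing on `(0, k*]` and strictly increasing on `[k*, ∞)`: the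
approximate Bloom filter false positive rate first decreases, reaches its minimum at
`k = (m ln 2)/n`, and then increases. -/
theorem approx_fpr_antitone_then_monotone (a : ℝ) (ha : 0 < a) :
    StrictAntiOn (fun k : ℝ => (1 - Real.exp (-a * k)) ^ k)
      (Set.Ioc (0 : ℝ) (Real.log 2 / a)) ∧
    StrictMonoOn (fun k : ℝ => (1 - Real.exp (-a * k)) ^ k)
      (Set.Ici (Real.log 2 / a)) := by
  have half : Real.exp (-a * (Real.log 2 / a)) = 1 / 2 := by
    rw [neg_mul, mul_div_cancel₀ _ ha.ne', Real.exp_neg, Real.exp_log two_pos, one_div]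
  have anti : StrictAnti fun k : ℝ => Real.exp (-a * k) := fun x y hxy =>
    Real.exp_lt_exp.2 (by nlinarith)
  constructor
  · intro x hx y hy hxy
    have hx1 : Real.exp (-a * x) < 1 := by simpa using anti hx.1
    have hy2 : 1 / 2 ≤ Real.exp (-a * y) := half ▸ anti.antitone hy.2
    have hlt : Real.exp (-a * y) < Real.exp (-a * x) := anti hxy
    have h := strictMonoOn_log_mul_log_one_sub (a := 1 - Real.exp (-a * x))
      (b := 1 - Real.exp (-a * y)) ⟨by linarith, by linarith⟩ ⟨by linarith, by linarith⟩
      (by linarith)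
    simp only [sub_sub_cancel] at h
    simp only [one_sub_exp_rpow_eq ha hx.1, one_sub_exp_rpow_eq ha hy.1]
    rw [Real.exp_lt_exp]
    exact div_lt_div_of_pos_right (by linarith) ha
  · intro x hx y hy hxy
    have hx0 : 0 < x := (div_pos (Real.log_pos one_lt_two) ha).trans_le hx
    have hx2 : Real.exp (-a * x) ≤ 1 / 2 := half ▸ anti.antitone hx
    have hlt : Real.exp (-a * y) < Real.exp (-a * x) := anti hxy
    have h := strictMonoOn_log_mul_log_one_sub ⟨Real.exp_pos _, hlt.le.trans hx2⟩
      ⟨Real.exp_pos _, hx2⟩ hlt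
    simp only [one_sub_exp_rpow_eq ha hx0, one_sub_exp_rpow_eq ha (hx0.trans hxy)]
    rw [Real.exp_lt_exp]
    exact div_lt_div_of_pos_right (neg_lt_neg h) ha
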